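/- Let I ⊂ S = K[X_1,…,X_n] be a generalized Cohen–Macaulay monomial ideal such that √I is not Cohen–Macaulay. Then I is not Cohen–Macaulay, i.e., there exists i < dim S/I with H^i_m(S/I) ≠ 0. -/

import Mathlib

/-!
Formalization of results from "Combinatorial characterizations of generalized
Cohen-Macaulay monomial ideals" (Y. Takayama).

Setting: `K` a field, `S = K[X_1, …, X_n]` realized as `MvPolynomial (Fin n) K`,
`I ⊆ S` a monomial ideal whose minimal monomial generators have the exponent
vectors in `G : Finset (Fin n →₀ ℕ)`.
-/

set_option maxHeartbeats 1000000
set_option synthInstance.maxHeartbeats 400000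

open Finset MvPolynomial

namespace GH

variable (K : Type) [Field K]

/-- exponent vectors of monomials in `n` variables -/
abbrev Expo (n : ℕ) := Fin n →₀ ℕ

/-- the monomial ideal of `S = K[X_1, …, X_n]` generated by the monomials `X^u`, `u ∈ G` -/
noncomputable def monIdeal {n : ℕ} (G : Finset (Expo n)) : Ideal (MvPolynomial (Fin n) K) :=
  Ideal.span ((fun u => monomial u (1 : K)) '' ↑G)

/-- `G` is a minimal set of (exponent vectors of) monomial generators, i.e.
`{X^u : u ∈ G}` is the minimal set `G(I)` of monomial generators of `monIdeal K G` -/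
def MinGens {n : ℕ} (G : Finset (Expo n)) : Prop :=
  (∀ u ∈ G, u ≠ 0) ∧ ∀ u ∈ G, ∀ v ∈ G, u ≤ v → u = v

/-- `ρ_j = max{ν_j(u) : u ∈ G(I)}`, the maximal exponent of `X_j` in the generators -/
def rho {n : ℕ} (G : Finset (Expo n)) (j : Fin n) : ℕ := G.sup fun u => u j

/-- `G_a = {i : a_i < 0}` for a multidegree `a ∈ ℤⁿ` -/
def negSet {n : ℕ} (a : Fin n → ℤ) : Finset (Fin n) := univ.filter fun i => a i < 0

/-- the condition "for every `u ∈ G(I)` there exists `j ∉ F` with `ν_j(u) > a_j ≥ 0`" -/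
def hits {n : ℕ} (G : Finset (Expo n)) (a : Fin n → ℤ) (F : Finset (Fin n)) : Prop :=
  ∀ u ∈ G, ∃ j, j ∉ F ∧ 0 ≤ a j ∧ a j < (u j : ℤ)

/-- abstract simplicial complexes on (a subset of) the vertex set `Fin n`;
the empty face is allowed as a face and the void complex is allowed -/
structure SComplex (n : ℕ) where
  faces : Set (Finset (Fin n))
  down_closed : ∀ ⦃F⦄, F ∈ faces → ∀ ⦃F'⦄, F' ⊆ F → F' ∈ faces

/-- the simplicial complex
`Δ_a = {F - G_a : F ⊇ G_a and ∀ u ∈ G(I) ∃ j ∉ F, ν_j(u) > a_j ≥ 0}` -/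
def deltaA {n : ℕ} (G : Finset (Expo n)) (a : Fin n → ℤ) : SComplex n where
  faces := {σ | Disjoint σ (negSet a) ∧ hits G a (σ ∪ negSet a)}
  down_closed := by
    intro F hF F' hsub
    refine ⟨hF.1.mono_left hsub, fun u hu => ?_⟩
    obtain ⟨j, hj, h⟩ := hF.2 u hu
    exact ⟨j, fun hm => hj (Finset.union_subset_union hsub (Finset.Subset.refl _) hm), h⟩

/-- the Stanley–Reisner complex `Δ` of `√I`: `F ∈ Δ` iff `∏_{i ∈ F} X_i ∉ √I` -/
noncomputable def srComplex {n : ℕ} (G : Finset (Expo n)) : SComplex n where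
  faces := {F | (∏ i ∈ F, (X i : MvPolynomial (Fin n) K)) ∉ (monIdeal K G).radical}
  down_closed := by
    intro F hF F' hsub hmem
    exact hF (by rw [← Finset.prod_sdiff hsub]; exact Ideal.mul_mem_left _ _ hmem)

/-- the graded maximal ideal `𝔪 = (X_1, …, X_n)` of `S` (also denoted `m`);
local cohomology of `S/I` with respect to the maximal ideal of `S/I` agrees with
local cohomology over `S` with respect to `𝔪` -/
noncomputable def idealM (n : ℕ) : Ideal (MvPolynomial (Fin n) K) :=
  Ideal.span (Set.range (X : Fin n → MvPolynomial (Fin n) K))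

/-- the `i`-th local cohomology module `H^i_𝔪(S/I)`, as an `S`-module -/
noncomputable def locCoh {n : ℕ} (I : Ideal (MvPolynomial (Fin n) K)) (i : ℕ) :
    ModuleCat (MvPolynomial (Fin n) K) :=
  (localCohomology (idealM K n) i).obj
    (ModuleCat.of (MvPolynomial (Fin n) K) (MvPolynomial (Fin n) K ⧸ I))

/-- an ideal `I ⊆ S` is generalized Cohen–Macaulay (FLC) if `H^i_𝔪(S/I)` has finite
length for every `i ≠ dim S/I` -/
def IsGenCM {n : ℕ} (I : Ideal (MvPolynomial (Fin n) K)) : Prop :=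
  ∀ i : ℕ, (i : WithBot (WithTop ℕ)) ≠ ringKrullDim (MvPolynomial (Fin n) K ⧸ I) →
    IsFiniteLength (MvPolynomial (Fin n) K) (locCoh K I i)

section homological

open CategoryTheory Limits Opposite

universe v u v₁ u₁ v₂ u₂

lemma comp_square_comp {C : Type u} [Category.{v} C] {A₁ A₂ B₁ B₂ C₁ C₂ : C}
    {f : A₁ ⟶ A₂} {g : B₁ ⟶ B₂} {h : C₁ ⟶ C₂}
    {p : A₁ ⟶ B₁} {p' : A₂ ⟶ B₂} {q : B₁ ⟶ C₁} {q' : B₂ ⟶ C₂}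
    (h₁ : f ≫ p' = p ≫ g) (h₂ : g ≫ q' = q ≫ h) :
    f ≫ p' ≫ q' = (p ≫ q) ≫ h := by
  rw [reassoc_of% h₁, h₂, Category.assoc]

/-- Left derived functors commute with post-composition by an exact functor. -/
noncomputable def leftDerivedCompExact {C : Type u} [Category.{v} C] [Abelian C]
    [HasProjectiveResolutions C]
    {D : Type u₁} [Category.{v₁} D] [Abelian D]
    {D' : Type u₂} [Category.{v₂} D'] [Abelian D']
    (F : C ⥤ D) [F.Additive] (E : D ⥤ D') [E.Additive] [E.PreservesHomology] (n : ℕ) :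
    (F ⋙ E).leftDerived n ≅ F.leftDerived n ⋙ E :=
  NatIso.ofComponents
    (fun X => (projectiveResolution X).isoLeftDerivedObj (F ⋙ E) n ≪≫
      ShortComplex.mapHomologyIso
        (((F.mapHomologicalComplex _).obj (projectiveResolution X).complex).sc n) E ≪≫
      E.mapIso ((projectiveResolution X).isoLeftDerivedObj F n).symm)
    (by
      intro X Y f
      have comm := ProjectiveResolution.lift_commutes_zero f (projectiveResolution X)
        (projectiveResolution Y)
      have h1 := ProjectiveResolution.isoLeftDerivedObj_hom_naturality f _ _ _ comm (F ⋙ E) n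
      have h2 := congrArg E.map
        (ProjectiveResolution.isoLeftDerivedObj_inv_naturality f _ _ _ comm F n)
      rw [Functor.map_comp, Functor.map_comp] at h2
      have h3 := ShortComplex.mapHomologyIso_hom_naturality
        ((HomologicalComplex.shortComplexFunctor D _ n).map ((F.mapHomologicalComplex _).map
          (ProjectiveResolution.lift f (projectiveResolution X) (projectiveResolution Y)))) E
      exact comp_square_comp h1 (comp_square_comp h3 h2.symm))

/-- An exact functor preserving projective objects maps projective resolutions to projective
resolutions. -/
noncomputable def mapProjectiveResolution {C : Type u} [Category.{v} C] [Abelian C]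
    {D : Type u₁} [Category.{v₁} D] [Abelian D] (Φ : C ⥤ D) [Φ.Additive] [Φ.PreservesHomology]
    [Φ.PreservesProjectiveObjects] {X : C} (P : ProjectiveResolution X) :
    ProjectiveResolution (Φ.obj X) where
  complex := (Φ.mapHomologicalComplex _).obj P.complex
  projective n := Φ.projective_obj (P.complex.X n)
  π := (Φ.mapHomologicalComplex _).map P.π ≫
    (HomologicalComplex.singleMapHomologicalComplex Φ _ 0).hom.app X
  quasiIso := inferInstance

lemma mapProjectiveResolution_π_f_zero {C : Type u} [Category.{v} C] [Abelian C]
    {D : Type u₁} [Category.{v₁} D] [Abelian D] (Φ : C ⥤ D) [Φ.Additive] [Φ.PreservesHomology]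
    [Φ.PreservesProjectiveObjects] {X : C} (P : ProjectiveResolution X) :
    (mapProjectiveResolution Φ P).π.f 0 = Φ.map (P.π.f 0) := by
  have key {A B : C} (a : A ⟶ B) : Φ.map a ≫ Φ.map (𝟙 B) ≫ 𝟙 (Φ.obj B) = Φ.map a := by simp
  exact (congrArg (Φ.map (P.π.f 0) ≫ ·)
    (HomologicalComplex.singleMapHomologicalComplex_hom_app_self Φ _ 0 X)).trans (key _)

/-- Left derived functors commute with pre-composition by an exact functor which
preserves projective objects. -/
noncomputable def precompLeftDerived {C : Type u} [Category.{v} C] [Abelian C]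
    [HasProjectiveResolutions C]
    {D : Type u₁} [Category.{v₁} D] [Abelian D] [HasProjectiveResolutions D]
    {D' : Type u₂} [Category.{v₂} D'] [Abelian D']
    (Φ : C ⥤ D) [Φ.Additive] [Φ.PreservesHomology] [Φ.PreservesProjectiveObjects]
    (F : D ⥤ D') [F.Additive] (n : ℕ) :
    (Φ ⋙ F).leftDerived n ≅ Φ ⋙ F.leftDerived n :=
  NatIso.ofComponents
    (fun X => (projectiveResolution X).isoLeftDerivedObj (Φ ⋙ F) n ≪≫
      ((mapProjectiveResolution Φ (projectiveResolution X)).isoLeftDerivedObj F n).symm)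
    (by
      intro X Y f
      have comm := ProjectiveResolution.lift_commutes_zero f (projectiveResolution X)
        (projectiveResolution Y)
      have h1 := ProjectiveResolution.isoLeftDerivedObj_hom_naturality f _ _ _ comm (Φ ⋙ F) n
      have map_square {A₁ A₂ B₁ B₂ : C} {f : A₁ ⟶ A₂} {g : B₁ ⟶ B₂} {p : A₁ ⟶ B₁} {q : A₂ ⟶ B₂}
          (h : f ≫ q = p ≫ g) : Φ.map f ≫ Φ.map q = Φ.map p ≫ Φ.map g := by
        rw [← Functor.map_comp, h, Functor.map_comp]
      have comm' := map_square comm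
      rw [← mapProjectiveResolution_π_f_zero, ← mapProjectiveResolution_π_f_zero] at comm'
      have h2 := ProjectiveResolution.isoLeftDerivedObj_inv_naturality (Φ.map f)
        (mapProjectiveResolution Φ (projectiveResolution X))
        (mapProjectiveResolution Φ (projectiveResolution Y))
        ((Φ.mapHomologicalComplex _).map (ProjectiveResolution.lift f (projectiveResolution X)
          (projectiveResolution Y))) comm' F n
      exact comp_square_comp h1 h2.symm)

/-- Naturally isomorphic functors have naturally isomorphic left derived functors. -/
noncomputable def leftDerivedCongr {C : Type u} [Category.{v} C] [Abelian C]
    [HasProjectiveResolutions C]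
    {D : Type u₁} [Category.{v₁} D] [Abelian D] {F G : C ⥤ D} [F.Additive] [G.Additive]
    (e : F ≅ G) (n : ℕ) :
    F.leftDerived n ≅ G.leftDerived n where
  hom := NatTrans.leftDerived e.hom n
  inv := NatTrans.leftDerived e.inv n
  hom_inv_id := by rw [← NatTrans.leftDerived_comp]; simp
  inv_hom_id := by rw [← NatTrans.leftDerived_comp]; simp

/-- The functor `X ↦ Hom(X, M)` into abelian groups, as a covariant functor to the opposite
category. -/
noncomputable def homAddGrp {R : Type} [CommRing R] (M : ModuleCat.{0} R) :
    ModuleCat.{0} R ⥤ AddCommGrpCat.{0}ᵒᵖ :=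
  ((linearYoneda R (ModuleCat.{0} R)).obj M).rightOp ⋙ (forget₂ _ AddCommGrpCat).op

instance {R : Type} [CommRing R] (M : ModuleCat.{0} R) : (homAddGrp M).Additive := by
  unfold homAddGrp
  infer_instance

/-- The additive group underlying `Ext` is computed by deriving `homAddGrp`. -/
noncomputable def homAddGrpLeftDerivedIso {R : Type} [CommRing R] (M : ModuleCat.{0} R) (n : ℕ) :
    (homAddGrp M).leftDerived n ≅
      (((linearYoneda R (ModuleCat.{0} R)).obj M).rightOp).leftDerived n ⋙
        (forget₂ _ AddCommGrpCat).op :=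
  have := preservesFiniteLimits_op (forget₂ (ModuleCat.{0} R) AddCommGrpCat)
  have := preservesFiniteColimits_op (forget₂ (ModuleCat.{0} R) AddCommGrpCat)
  leftDerivedCompExact _ _ n

/-- The adjunction between extension and restriction of scalars, in terms of `homAddGrp`. -/
noncomputable def homAddGrpRestrictIso {R S : Type} [CommRing R] [CommRing S] (f : R →+* S)
    (M : ModuleCat.{0} S) :
    homAddGrp ((ModuleCat.restrictScalars f).obj M) ≅ ModuleCat.extendScalars f ⋙ homAddGrp M :=
  have : (ModuleCat.extendScalars f).Additive :=
    (ModuleCat.extendRestrictScalarsAdj f).left_adjoint_additive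
  NatIso.ofComponents
    (fun X => (((ModuleCat.extendRestrictScalarsAdj f).homAddEquiv X M).toAddCommGrpIso).op)
    (by
      intro X Y g
      apply Quiver.Hom.unop_inj
      ext x
      exact ((ModuleCat.extendRestrictScalarsAdj f).homEquiv_naturality_left g x).symm)

lemma preservesProjectiveObjects_extendScalars {R S : Type} [CommRing R] [CommRing S]
    (f : R →+* S) : (ModuleCat.extendScalars.{0, 0, 0} f).PreservesProjectiveObjects where
  projective_obj {X} hX := (ModuleCat.extendRestrictScalarsAdj f).map_projective X hX

/-- Flat base change for `Ext`, on underlying additive groups. -/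
noncomputable def extRestrictScalarsIso {R S : Type} [CommRing R] [CommRing S] (f : R →+* S)
    (hf : f.Flat) (M : ModuleCat.{0} S) (n : ℕ) :
    (((linearYoneda R _).obj ((ModuleCat.restrictScalars f).obj M)).rightOp).leftDerived n ⋙
        (forget₂ _ AddCommGrpCat).op ≅
      ModuleCat.extendScalars f ⋙ (((linearYoneda S _).obj M).rightOp).leftDerived n ⋙
        (forget₂ _ AddCommGrpCat).op :=
  have : (ModuleCat.extendScalars f).Additive :=
    (ModuleCat.extendRestrictScalarsAdj f).left_adjoint_additive
  have := preservesProjectiveObjects_extendScalars f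
  have := ModuleCat.preservesFiniteLimits_extendScalars_of_flat hf
  have : PreservesFiniteColimits (ModuleCat.extendScalars.{0, 0, 0} f) :=
    have := (ModuleCat.extendRestrictScalarsAdj f).leftAdjoint_preservesColimits
    inferInstance
  (homAddGrpLeftDerivedIso _ n).symm ≪≫ leftDerivedCongr (homAddGrpRestrictIso f M) n ≪≫
    precompLeftDerived (ModuleCat.extendScalars f) (homAddGrp M) n ≪≫
    Functor.isoWhiskerLeft _ (homAddGrpLeftDerivedIso M n)

/-- The morphism out of a cyclic module determined by the image of its generator. -/
noncomputable def quotientDesc {R : Type} [CommRing R] (I : Ideal R) (N : ModuleCat.{0} R) (y : N)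
    (h : ∀ x ∈ I, x • y = 0) : ModuleCat.of R (R ⧸ I) ⟶ N :=
  ModuleCat.ofHom (Submodule.liftQ I (LinearMap.toSpanSingleton R N y) h)

lemma quotientDesc_mk {R : Type} [CommRing R] (I : Ideal R) (N : ModuleCat.{0} R) (y : N)
    (h : ∀ x ∈ I, x • y = 0) (x : R) :
    (quotientDesc I N y h).hom (Ideal.Quotient.mk I x) = x • y := rfl

/-- The comparison map from the base change of `R ⧸ I` to `S ⧸ J`. -/
noncomputable def extendQuotientHom {R S : Type} [CommRing R] [CommRing S] (f : R →+* S)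
    (I : Ideal R) (J : Ideal S) (h : I.map f ≤ J) :
    (ModuleCat.extendScalars f).obj (ModuleCat.of R (R ⧸ I)) ⟶ ModuleCat.of S (S ⧸ J) :=
  ((ModuleCat.extendRestrictScalarsAdj f).homEquiv _ _).symm
    (quotientDesc I ((ModuleCat.restrictScalars f).obj (ModuleCat.of S (S ⧸ J)))
      (Ideal.Quotient.mk J 1) fun x hx => by
        change Ideal.Quotient.mk J (f x * 1) = 0
        rw [mul_one, Ideal.Quotient.eq_zero_iff_mem]
        exact h (Ideal.mem_map_of_mem f hx))

open scoped ChangeOfRings in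
/-- The canonical map from a module to its base change, on elements. -/
noncomputable def oneTmul {R S : Type} [CommRing R] [CommRing S] (f : R →+* S)
    (M : ModuleCat.{0} R) (m : M) : (ModuleCat.extendScalars f).obj M :=
  (1 : S) ⊗ₜ[R,f] m

lemma smul_oneTmul {R S : Type} [CommRing R] [CommRing S] (f : R →+* S)
    (M : ModuleCat.{0} R) (x : R) (m : M) :
    f x • oneTmul f M m = oneTmul f M (x • m) :=
  (map_smul ((ModuleCat.extendRestrictScalarsAdj f).unit.app M).hom x m).symm

lemma extendQuotientHom_oneTmul {R S : Type} [CommRing R] [CommRing S] (f : R →+* S)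
    (I : Ideal R) (J : Ideal S) (h : I.map f ≤ J) (x : R) :
    (extendQuotientHom f I J h).hom (oneTmul f (ModuleCat.of R (R ⧸ I)) (Ideal.Quotient.mk I x)) =
      Ideal.Quotient.mk J (f x) := by
  refine (ModuleCat.extendRestrictScalarsAdj_homEquiv_apply (extendQuotientHom f I J h)
    (Ideal.Quotient.mk I x)).symm.trans ?_
  unfold extendQuotientHom
  rw [Equiv.apply_symm_apply]
  change Ideal.Quotient.mk J (f x * 1) = _
  rw [mul_one]

/-- The comparison map from `S ⧸ J` to the base change of `R ⧸ I`. -/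
noncomputable def extendQuotientInv {R S : Type} [CommRing R] [CommRing S] (f : R →+* S)
    (I : Ideal R) (J : Ideal S) (h : J ≤ I.map f) :
    ModuleCat.of S (S ⧸ J) ⟶ (ModuleCat.extendScalars f).obj (ModuleCat.of R (R ⧸ I)) :=
  quotientDesc J _ (oneTmul f (ModuleCat.of R (R ⧸ I)) (Ideal.Quotient.mk I 1)) fun y hy => by
    have key : I.map f ≤ LinearMap.ker (LinearMap.toSpanSingleton S
        ((ModuleCat.extendScalars f).obj (ModuleCat.of R (R ⧸ I)))
        (oneTmul f (ModuleCat.of R (R ⧸ I)) (Ideal.Quotient.mk I 1))) :=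
      Ideal.map_le_iff_le_comap.2 fun x hx => by
        have h0 : x • (Ideal.Quotient.mk I 1) = 0 := by
          change Ideal.Quotient.mk I (x * 1) = 0
          rw [mul_one, Ideal.Quotient.eq_zero_iff_mem]
          exact hx
        refine (smul_oneTmul f (ModuleCat.of R (R ⧸ I)) x (Ideal.Quotient.mk I 1)).trans ?_
        refine (congrArg (oneTmul f (ModuleCat.of R (R ⧸ I))) h0).trans ?_
        exact map_zero ((ModuleCat.extendRestrictScalarsAdj f).unit.app
          (ModuleCat.of R (R ⧸ I))).hom
    exact key (h hy)

/-- The base change of a quotient by an ideal is the quotient by the extended ideal. -/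
noncomputable def extendQuotientIso {R S : Type} [CommRing R] [CommRing S] (f : R →+* S)
    (I : Ideal R) (J : Ideal S) (h : I.map f = J) :
    (ModuleCat.extendScalars f).obj (ModuleCat.of R (R ⧸ I)) ≅ ModuleCat.of S (S ⧸ J) where
  hom := extendQuotientHom f I J h.le
  inv := extendQuotientInv f I J h.ge
  hom_inv_id := by
    apply ModuleCat.ExtendScalars.hom_ext
    intro m
    obtain ⟨x, rfl⟩ := Ideal.Quotient.mk_surjective m
    refine (congrArg (extendQuotientInv f I J h.ge).hom
      (extendQuotientHom_oneTmul f I J h.le x)).trans ?_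
    refine (smul_oneTmul f (ModuleCat.of R (R ⧸ I)) x (Ideal.Quotient.mk I 1)).trans ?_
    refine congrArg (oneTmul f (ModuleCat.of R (R ⧸ I))) (?_ : Ideal.Quotient.mk I (x * 1) = _)
    rw [mul_one]
  inv_hom_id := by
    apply ModuleCat.hom_ext
    apply LinearMap.ext
    intro m
    obtain ⟨y, rfl⟩ := Ideal.Quotient.mk_surjective m
    refine (map_smul (extendQuotientHom f I J h.le).hom y
      (oneTmul f (ModuleCat.of R (R ⧸ I)) (Ideal.Quotient.mk I 1))).trans ?_
    refine (congrArg (y • ·) (extendQuotientHom_oneTmul f I J h.le 1)).trans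
      (?_ : Ideal.Quotient.mk J (y * f 1) = _)
    rw [map_one, mul_one]
    rfl

/-- The quotients by the powers of an extended ideal are obtained by base change. -/
noncomputable def ringModIdealsExtendIso {R S : Type} [CommRing R] [CommRing S] (f : R →+* S)
    (J : Ideal R) :
    localCohomology.ringModIdeals (localCohomology.idealPowersDiagram J) ⋙
        ModuleCat.extendScalars f ≅
      localCohomology.ringModIdeals (localCohomology.idealPowersDiagram (J.map f)) :=
  NatIso.ofComponents
    (fun t => extendQuotientIso f (J ^ unop t) (J.map f ^ unop t) (Ideal.map_pow _ _ _))
    (by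
      intro s t g
      apply ModuleCat.ExtendScalars.hom_ext
      intro m
      obtain ⟨x, rfl⟩ := Ideal.Quotient.mk_surjective m
      refine (extendQuotientHom_oneTmul f _ _ (Ideal.map_pow _ _ _).le x).trans ?_
      exact (congrArg ((localCohomology.ringModIdeals
        (localCohomology.idealPowersDiagram (J.map f))).map g).hom
          (extendQuotientHom_oneTmul f _ _ (Ideal.map_pow _ _ _).le x)).symm)

lemma isZero_colimit_iff_forget₂ {R : Type} [CommRing R] {J : Type} [SmallCategory J]
    (F : J ⥤ ModuleCat.{0} R) :
    IsZero (colimit F) ↔ IsZero (colimit (F ⋙ forget₂ (ModuleCat.{0} R) AddCommGrpCat.{0})) := by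
  rw [← (preservesColimitIso (forget₂ (ModuleCat.{0} R) AddCommGrpCat.{0}) F).isZero_iff]
  rw [ModuleCat.isZero_iff_subsingleton, AddCommGrpCat.isZero_iff_subsingleton]
  rfl

/-- The directed system computing the additive group of local cohomology. -/
lemma isZero_localCohomology_iff {R : Type} [CommRing R] (J : Ideal R) (M : ModuleCat.{0} R)
    (n : ℕ) :
    IsZero ((localCohomology J n).obj M) ↔
      IsZero (colimit (localCohomology.ringModIdeals (localCohomology.idealPowersDiagram J) ⋙
        (((linearYoneda R _).obj M).rightOp).leftDerived n ⋙
          (forget₂ _ AddCommGrpCat.{0}).op).leftOp) := by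
  have e : (localCohomology J n).obj M ≅ colimit
      ((localCohomology.ringModIdeals (localCohomology.idealPowersDiagram J) ⋙
        (((linearYoneda R _).obj M).rightOp).leftDerived n).leftOp) :=
    colimitObjIsoColimitCompEvaluation
      (localCohomology.diagram (localCohomology.idealPowersDiagram J) n) M
  rw [e.isZero_iff, isZero_colimit_iff_forget₂]
  rfl

lemma isZero_localCohomology_restrictScalars {R S : Type} [CommRing R] [CommRing S] (f : R →+* S)
    (hf : f.Flat) (J : Ideal R) (M : ModuleCat.{0} S) (n : ℕ)
    (h : IsZero ((localCohomology (J.map f) n).obj M)) :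
    IsZero ((localCohomology J n).obj ((ModuleCat.restrictScalars f).obj M)) := by
  rw [isZero_localCohomology_iff] at h ⊢
  refine h.of_iso (HasColimit.isoOfNatIso ?_)
  have e := Functor.isoWhiskerLeft (localCohomology.ringModIdeals
      (localCohomology.idealPowersDiagram J)) (extRestrictScalarsIso f hf M n) ≪≫
    Functor.isoWhiskerRight (ringModIdealsExtendIso f J)
      ((((linearYoneda S _).obj M).rightOp).leftDerived n ⋙ (forget₂ _ AddCommGrpCat).op)
  exact { hom := NatTrans.leftOp e.inv, inv := NatTrans.leftOp e.hom,
          hom_inv_id := by rw [← NatTrans.leftOp_comp, e.hom_inv_id]; rfl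
          inv_hom_id := by rw [← NatTrans.leftOp_comp, e.inv_hom_id]; rfl }

end homological

/-- A ring homomorphism making the target a retract of a finite free module is flat. -/
lemma flat_of_retract_pi {R S ι : Type} [CommRing R] [CommRing S] [Finite ι] (f : R →+* S)
    (i : S →+ (ι → R)) (p : (ι → R) →+ S) (hi : ∀ s x, i (f s * x) = s • i x)
    (hp : ∀ (s : R) y, p (s • y) = f s * p y) (h : ∀ x, p (i x) = x) : f.Flat := by
  let := f.toAlgebra
  let i' : S →ₗ[R] (ι → R) := { i with map_smul' := hi }
  let p' : (ι → R) →ₗ[R] S := { p with map_smul' := hp }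
  exact Module.Flat.of_retract i' p' (LinearMap.ext h)

open CategoryTheory Limits in
lemma isZero_of_retract {C : Type*} [Category* C] [HasZeroMorphisms C] {X Y : C}
    (e : Retract X Y) (h : IsZero Y) : IsZero X := by
  rw [IsZero.iff_id_eq_zero, ← e.retract, h.eq_of_tgt e.i 0, zero_comp]

open CategoryTheory in
/-- Given a ring homomorphism `f : R →+* S` with an `R`-linear section `ρ`, and ideals `I`, `J`
compatible with both, `R ⧸ I` is a retract of `S ⧸ J` regarded as an `R`-module. -/
noncomputable def retractQuotient {R S : Type} [CommRing R] [CommRing S] (f : R →+* S)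
    (I : Ideal R) (J : Ideal S) (ρ : S →+ R) (hρ : ∀ s x, ρ (f s * x) = s * ρ x)
    (hf : ∀ s, ρ (f s) = s) (hI : ∀ x ∈ I, f x ∈ J) (hJ : ∀ x ∈ J, ρ x ∈ I) :
    Retract (ModuleCat.of R (R ⧸ I))
      ((ModuleCat.restrictScalars f).obj (ModuleCat.of S (S ⧸ J))) where
  i := quotientDesc I ((ModuleCat.restrictScalars f).obj (ModuleCat.of S (S ⧸ J)))
    (Ideal.Quotient.mk J 1) fun x hx => by
      change Ideal.Quotient.mk J (f x * 1) = 0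
      rw [mul_one, Ideal.Quotient.eq_zero_iff_mem]
      exact hI x hx
  r := by
    letI : Module R (S ⧸ J) := Module.compHom _ f
    let g : S ⧸ J →+ R ⧸ I := QuotientAddGroup.lift J.toAddSubgroup
      ((Ideal.Quotient.mk I).toAddMonoidHom.comp ρ)
      fun x hx => Ideal.Quotient.eq_zero_iff_mem.2 (hJ x hx)
    have hg : ∀ (s : R) (x : S ⧸ J), g (f s • x) = s • g x := by
      intro s x
      obtain ⟨x, rfl⟩ := Ideal.Quotient.mk_surjective x
      exact congrArg (Ideal.Quotient.mk I) (hρ s x)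
    exact ModuleCat.ofHom
      (X := (ModuleCat.restrictScalars f).obj (ModuleCat.of S (S ⧸ J)))
      (Y := R ⧸ I) { toFun := g, map_add' := map_add g, map_smul' := hg }
  retract := by
    apply ModuleCat.hom_ext
    apply LinearMap.ext
    intro x
    obtain ⟨x, rfl⟩ := Ideal.Quotient.mk_surjective x
    change Ideal.Quotient.mk I (ρ (f x * 1)) = Ideal.Quotient.mk I x
    rw [mul_one, hf]

/-- The reading of the coefficients with exponents congruent to `r` modulo `k`: the linear map
which divides exponents `m ≡ r` by `k` and kills the other monomials. -/
noncomputable def expandCoeff {K : Type} [Field K] {n : ℕ} (k : ℕ) (r : Expo n) :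
    MvPolynomial (Fin n) K →ₗ[K] MvPolynomial (Fin n) K :=
  (basisMonomials (Fin n) K).constr K fun m =>
    if m.mapRange (· % k) (Nat.zero_mod k) = r then
      monomial (m.mapRange (· / k) (Nat.zero_div k)) 1 else 0

section expandCoeff

variable {K : Type} [Field K] {n : ℕ}

lemma expandCoeff_monomial (k : ℕ) (r m : Expo n) (c : K) :
    expandCoeff k r (monomial m c) = if m.mapRange (· % k) (Nat.zero_mod k) = r then
      monomial (m.mapRange (· / k) (Nat.zero_div k)) c else 0 := by
  have h1 : monomial m c = c • basisMonomials (Fin n) K m := by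
    rw [coe_basisMonomials, smul_monomial, smul_eq_mul, mul_one]
  rw [h1, map_smul, expandCoeff, Module.Basis.constr_basis, smul_ite, smul_zero, smul_monomial,
    smul_eq_mul, mul_one]

lemma expandCoeff_expand_mul {k : ℕ} (hk : 0 < k) (r : Expo n)
    (s x : MvPolynomial (Fin n) K) :
    expandCoeff k r (expand k s * x) = s * expandCoeff k r x := by
  induction s using MvPolynomial.induction_on' with
  | add p q hp hq => rw [map_add, add_mul, map_add, hp, hq, add_mul]
  | monomial a c =>
    induction x using MvPolynomial.induction_on' with
    | add p q hp hq => rw [mul_add, map_add, hp, hq, map_add, mul_add]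
    | monomial b d =>
      rw [expand_monomial, monomial_mul, expandCoeff_monomial, expandCoeff_monomial, mul_ite,
        mul_zero, monomial_mul]
      have h1 : (k • a + b).mapRange (· % k) (Nat.zero_mod k) =
          b.mapRange (· % k) (Nat.zero_mod k) := by
        ext i; simp
      have h2 : (k • a + b).mapRange (· / k) (Nat.zero_div k) =
          a + b.mapRange (· / k) (Nat.zero_div k) := by
        ext i; simp [Nat.mul_add_div hk]
      rw [h1, h2]

lemma expandCoeff_expand {k : ℕ} (hk : 0 < k) (s : MvPolynomial (Fin n) K) :
    expandCoeff k 0 (expand k s) = s := by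
  have h := expandCoeff_expand_mul hk 0 s 1
  rw [mul_one] at h
  rw [h, ← C_1, C_apply, expandCoeff_monomial, if_pos (by ext; simp)]
  simp

lemma sum_expand_expandCoeff {k : ℕ} (hk : 0 < k) (x : MvPolynomial (Fin n) K) :
    ∑ r : Fin n → Fin k, expand k (expandCoeff k
      (Finsupp.equivFunOnFinite.symm fun i => (r i : ℕ)) x) *
        monomial (Finsupp.equivFunOnFinite.symm fun i => (r i : ℕ)) 1 = x := by
  induction x using MvPolynomial.induction_on' with
  | add p q hp hq =>
    simp only [map_add, add_mul, Finset.sum_add_distrib]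
    rw [hp, hq]
  | monomial m c =>
    rw [Finset.sum_eq_single fun i => ⟨m i % k, Nat.mod_lt _ hk⟩]
    · rw [expandCoeff_monomial, if_pos (by ext; simp), expand_monomial, monomial_mul, mul_one]
      refine congrArg (fun a => monomial a c) (Finsupp.ext fun i => ?_)
      exact Nat.div_add_mod (m i) k
    · intro r _ hr
      rw [expandCoeff_monomial, if_neg, map_zero, zero_mul]
      intro h
      apply hr
      ext i
      have := DFunLike.congr_fun h i
      simpa using this.symm
    · intro h
      exact absurd (Finset.mem_univ _) h

/-- The power-of-variables endomorphism `X_i ↦ X_i ^ k` is flat. -/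
lemma flat_expand {k : ℕ} (hk : 0 < k) :
    ((expand k : MvPolynomial (Fin n) K →ₐ[K] MvPolynomial (Fin n) K) :
      MvPolynomial (Fin n) K →+* MvPolynomial (Fin n) K).Flat := by
  let e : (Fin n → Fin k) → Expo n := fun r => Finsupp.equivFunOnFinite.symm fun i => (r i : ℕ)
  refine flat_of_retract_pi _ (AddMonoidHom.mk' (fun x r => expandCoeff k (e r) x) ?_)
    (AddMonoidHom.mk' (fun y => ∑ r, expand k (y r) * monomial (e r) 1) ?_) ?_ ?_ ?_
  · intro x y
    ext1 r
    exact map_add _ x y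
  · intro x y
    simp only [Pi.add_apply, map_add, add_mul, Finset.sum_add_distrib]
  · intro s x
    ext1 r
    exact expandCoeff_expand_mul hk (e r) s x
  · intro s y
    change ∑ r, expand k (s * y r) * monomial (e r) 1 =
      expand k s * ∑ r, expand k (y r) * monomial (e r) 1
    rw [Finset.mul_sum]
    simp only [map_mul, mul_assoc]
  · exact sum_expand_expandCoeff hk

end expandCoeff

section monIdeal

variable {K : Type} [Field K] {n : ℕ} (G : Finset (Expo n))

lemma mem_monIdeal {x : MvPolynomial (Fin n) K} :
    x ∈ monIdeal K G ↔ ∀ m ∈ x.support, ∃ u ∈ G, u ≤ m :=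
  mem_ideal_span_monomial_image

lemma monomial_mem_monIdeal {u m : Expo n} (hu : u ∈ G) (h : u ≤ m) (c : K) :
    monomial m c ∈ monIdeal K G := by
  rw [mem_monIdeal]
  intro m' hm'
  rw [Finset.mem_singleton.1 (support_monomial_subset hm')]
  exact ⟨u, hu, h⟩

lemma expandCoeff_mem_radical {k : ℕ} {x : MvPolynomial (Fin n) K} (hx : x ∈ monIdeal K G) :
    expandCoeff k 0 x ∈ (monIdeal K G).radical := by
  rw [x.as_sum, map_sum]
  refine Ideal.sum_mem _ fun m hm => ?_
  rw [expandCoeff_monomial]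
  split_ifs with h
  · obtain ⟨u, hu, hum⟩ := (mem_monIdeal G).1 hx m hm
    refine ⟨k, ?_⟩
    rw [monomial_pow]
    refine monomial_mem_monIdeal G hu (hum.trans (le_of_eq ?_)) _
    ext i
    have hi : m i % k = 0 := by simpa using DFunLike.congr_fun h i
    simpa using (Nat.mul_div_cancel' (Nat.dvd_of_mod_eq_zero hi)).symm
  · exact Ideal.zero_mem _

/-- A polynomial killed by setting the variables in `T` to zero lies in the ideal they generate. -/
lemma mem_span_X_of_aeval_eq_zero (T : Set (Fin n)) [DecidablePred (· ∈ T)]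
    {s : MvPolynomial (Fin n) K}
    (h : aeval (fun i => if i ∈ T then (0 : MvPolynomial (Fin n) K) else X i) s = 0) :
    s ∈ Ideal.span (X '' T : Set (MvPolynomial (Fin n) K)) := by
  have key : (Ideal.Quotient.mkₐ K (Ideal.span (X '' T : Set (MvPolynomial (Fin n) K)))).comp
      (aeval fun i => if i ∈ T then (0 : MvPolynomial (Fin n) K) else X i) =
      Ideal.Quotient.mkₐ K _ := by
    apply MvPolynomial.algHom_ext
    intro i
    rw [AlgHom.comp_apply, aeval_X]
    split_ifs with hi
    · rw [map_zero]
      exact (Ideal.Quotient.eq_zero_iff_mem.2 (Ideal.subset_span (Set.mem_image_of_mem X hi))).symm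
    · rfl
  have := AlgHom.congr_fun key s
  rw [AlgHom.comp_apply, h, map_zero] at this
  exact Ideal.Quotient.eq_zero_iff_mem.1 this.symm

lemma expand_mem_monIdeal {k : ℕ} (hk : ∀ u ∈ G, ∀ i, u i ≤ k) {s : MvPolynomial (Fin n) K}
    (hs : s ∈ (monIdeal K G).radical) : expand k s ∈ monIdeal K G := by
  classical
  rw [s.as_sum, map_sum]
  refine Ideal.sum_mem _ fun w hw => ?_
  rw [expand_monomial]
  by_cases hG : ∃ u ∈ G, u ≤ k • w
  · obtain ⟨u, hu, h⟩ := hG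
    exact monomial_mem_monIdeal G hu h _
  · exfalso
    push Not at hG
    let ev : MvPolynomial (Fin n) K →ₐ[K] MvPolynomial (Fin n) K :=
      aeval fun i => if i ∈ {i | w i = 0} then (0 : MvPolynomial (Fin n) K) else X i
    have h1 : monIdeal K G ≤ RingHom.ker ev := by
      refine Ideal.span_le.2 ?_
      rintro _ ⟨u, hu, rfl⟩
      obtain ⟨i, hi⟩ : ∃ i, ¬ u i ≤ k * w i := by
        by_contra! hcon
        exact hG u hu fun i => by simpa using hcon i
      have hw0 : w i = 0 := by
        by_contra hne
        exact hi ((hk u hu i).trans (Nat.le_mul_of_pos_right k (Nat.pos_of_ne_zero hne)))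
      have hui : u i ≠ 0 := by
        intro h0
        exact hi (h0 ▸ Nat.zero_le _)
      change ev (monomial u 1) = 0
      rw [aeval_monomial, Finsupp.prod,
        Finset.prod_eq_zero (Finsupp.mem_support_iff.2 hui), mul_zero]
      rw [if_pos (show i ∈ {i | w i = 0} from hw0), zero_pow hui]
    obtain ⟨N, hN⟩ := hs
    have h2 : ev s = 0 := by
      have := h1 hN
      rw [RingHom.mem_ker, map_pow] at this
      exact eq_zero_of_pow_eq_zero this
    obtain ⟨i, hi, hne⟩ := mem_ideal_span_X_image.1 (mem_span_X_of_aeval_eq_zero _ h2) w hw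
    exact hne hi

lemma radical_map_expand_idealM {k : ℕ} (hk : 0 < k) :
    ((idealM K n).map ((expand k : MvPolynomial (Fin n) K →ₐ[K] MvPolynomial (Fin n) K) :
      MvPolynomial (Fin n) K →+* MvPolynomial (Fin n) K)).radical = (idealM K n).radical := by
  apply le_antisymm
  · refine Ideal.radical_mono (Ideal.map_le_iff_le_comap.2 (Ideal.span_le.2 ?_))
    rintro _ ⟨i, rfl⟩
    change expand k (X i) ∈ idealM K n
    rw [expand_X]
    exact Ideal.pow_mem_of_mem _ (Ideal.subset_span (Set.mem_range_self i)) k hk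
  · refine Ideal.radical_le_radical_iff.2 (Ideal.span_le.2 ?_)
    rintro _ ⟨i, rfl⟩
    refine ⟨k, ?_⟩
    have := Ideal.mem_map_of_mem ((expand k : MvPolynomial (Fin n) K →ₐ[K]
      MvPolynomial (Fin n) K) : MvPolynomial (Fin n) K →+* MvPolynomial (Fin n) K)
      (Ideal.subset_span (Set.mem_range_self i) : (X i : MvPolynomial (Fin n) K) ∈ idealM K n)
    rwa [RingHom.coe_coe, expand_X] at this

open CategoryTheory Limits in
/-- Vanishing of local cohomology passes from `S ⧸ I` to `S ⧸ √I`. -/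
lemma subsingleton_locCoh_radical (i : ℕ) (h : Subsingleton (locCoh K (monIdeal K G) i)) :
    Subsingleton (locCoh K (monIdeal K G).radical i) := by
  let k := G.sup (fun u => Finset.univ.sup u) + 1
  have hk : 0 < k := Nat.succ_pos _
  have hG : ∀ u ∈ G, ∀ i, u i ≤ k := fun u hu i =>
    (Finset.le_sup (f := u) (Finset.mem_univ i)).trans
      ((Finset.le_sup (f := fun u : Expo n => Finset.univ.sup u) hu).trans (Nat.le_succ _))
  rw [← ModuleCat.isZero_iff_subsingleton] at h ⊢
  have h1 := h.of_iso ((localCohomology.isoOfSameRadical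
    (radical_map_expand_idealM (K := K) (n := n) hk) i).app _)
  have h2 := isZero_localCohomology_restrictScalars _ (flat_expand hk) _ _ _ h1
  let e := retractQuotient _ (monIdeal K G).radical (monIdeal K G)
    (expandCoeff k 0).toAddMonoidHom (expandCoeff_expand_mul hk 0) (expandCoeff_expand hk)
    (fun x hx => expand_mem_monIdeal G hG hx) (fun x hx => expandCoeff_mem_radical G hx)
  exact isZero_of_retract (e.map (localCohomology (idealM K n) i)) h2

end monIdeal

/-- **Corollary 2.8.** Let `I ⊆ S` be a generalized Cohen–Macaulay
monomial ideal such that `√I` is not Cohen–Macaulay. Then `I` is not Cohen–Macaulay,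
i.e. there exists `i < dim S/I` with `H^i_𝔪(S/I) ≠ 0`. -/
theorem not_CM_of_radical_not_CM {n : ℕ} (G : Finset (Expo n)) (hG : MinGens G)
    (hgcm : IsGenCM K (monIdeal K G))
    (hrad : ∃ i : ℕ,
      (i : WithBot (WithTop ℕ)) <
          ringKrullDim (MvPolynomial (Fin n) K ⧸ (monIdeal K G).radical) ∧
        Nontrivial (locCoh K (monIdeal K G).radical i)) :
    ∃ i : ℕ,
      (i : WithBot (WithTop ℕ)) < ringKrullDim (MvPolynomial (Fin n) K ⧸ monIdeal K G) ∧
        Nontrivial (locCoh K (monIdeal K G) i) := by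
  obtain ⟨i, hi, hnt⟩ := hrad
  refine ⟨i, hi.trans_le (ringKrullDim_le_of_surjective
    (Ideal.Quotient.factor Ideal.le_radical) (Ideal.Quotient.factor_surjective _)), ?_⟩
  by_contra hcon
  rw [not_nontrivial_iff_subsingleton] at hcon
  exact not_subsingleton_iff_nontrivial.2 hnt (subsingleton_locCoh_radical G i hcon)

end GH
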